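/- (Derivative identity) If f ∈ AC(ℝ), then for every t ∈ ℝ, w > 0 and m ∈ ℕ, m ≥ 1, the derivative of the averaged generalized sampling series equals an average of translated sampling Kantorovich operators of f': (S̄ᵐ_w f)'(t) = (1/m) ∑_{i=1}^{m} (K_w f')( t − (m − 2(i−1))/(2w) ). -/

import Mathlib

open MeasureTheory

noncomputable def avgKernel (χ : ℝ → ℝ) (m : ℕ) (t : ℝ) : ℝ :=
  (1 / (m : ℝ)) * ∫ v in (-((m : ℝ) / 2))..((m : ℝ) / 2), χ (t + v)

noncomputable def avgSamplingSeries (χ f : ℝ → ℝ) (m : ℕ) (w t : ℝ) : ℝ :=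
  ∑' k : ℤ, f ((k : ℝ) / w) * avgKernel χ m (w * t - (k : ℝ))

noncomputable def kantorovich (χ g : ℝ → ℝ) (w t : ℝ) : ℝ :=
  ∑' k : ℤ, (w * ∫ u in ((k : ℝ) / w)..(((k : ℝ) + 1) / w), g u) * χ (w * t - (k : ℝ))

def ACOn (f : ℝ → ℝ) (a b : ℝ) : Prop :=
  ∀ ε > (0 : ℝ), ∃ δ > (0 : ℝ), ∀ (n : ℕ) (s t : ℕ → ℝ),
    (∀ i < n, a ≤ s i ∧ s i ≤ t i ∧ t i ≤ b) →
    (Set.PairwiseDisjoint (↑(Finset.range n)) fun i => Set.Ioo (s i) (t i)) →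
    (∑ i ∈ Finset.range n, (t i - s i)) < δ →
    (∑ i ∈ Finset.range n, |f (t i) - f (s i)|) < ε

def ACloc (f : ℝ → ℝ) : Prop := ∀ a b : ℝ, ACOn f a b

theorem ACOn.absolutelyContinuousOnInterval {f : ℝ → ℝ} {a b : ℝ} (hab : a ≤ b)
    (h : ACOn f a b) : AbsolutelyContinuousOnInterval f a b := by
  rw [absolutelyContinuousOnInterval_iff]
  intro ε hε
  obtain ⟨δ, hδ, H⟩ := h ε hε
  refine ⟨δ, hδ, ?_⟩
  rintro ⟨n, I⟩ ⟨hI, hdisj⟩ hsum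
  have hdist : ∀ g : ℝ → ℝ, ∀ i,
      |g (max (I i).1 (I i).2) - g (min (I i).1 (I i).2)| = dist (g (I i).1) (g (I i).2) := by
    intro g i
    rcases le_total (I i).1 (I i).2 with hi | hi
    · rw [max_eq_right hi, min_eq_left hi, dist_comm, Real.dist_eq]
    · rw [max_eq_left hi, min_eq_right hi, Real.dist_eq]
  have hH := H n (fun i => min (I i).1 (I i).2) (fun i => max (I i).1 (I i).2) ?_ ?_ ?_
  · simpa only [hdist f] using hH
  · intro i hi
    have hmem := hI i (Finset.mem_range.mpr hi)
    simp only [Set.uIcc_of_le hab, Set.mem_Icc] at hmem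
    exact ⟨le_min hmem.1.1 hmem.2.1, min_le_max, max_le hmem.1.2 hmem.2.2⟩
  · intro i hi j hj hij
    exact (hdisj hi hj hij).mono Set.Ioo_subset_Ioc_self Set.Ioo_subset_Ioc_self
  · refine lt_of_eq_of_lt (Finset.sum_congr rfl fun i _ => ?_) hsum
    have := hdist id i
    simp only [id] at this
    rw [← this, abs_of_nonneg (sub_nonneg.mpr min_le_max)]

theorem ACloc.integral_deriv_eq_sub {f : ℝ → ℝ} (h : ACloc f) {a b : ℝ} (hab : a ≤ b) :
    ∫ u in a..b, deriv f u = f b - f a :=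
  ((h a b).absolutelyContinuousOnInterval hab).integral_deriv_eq_sub

theorem BoundedVariationOn.summable_abs_sub_nat {f : ℝ → ℝ}
    (h : BoundedVariationOn f Set.univ) {u : ℕ → ℝ} (hu : Monotone u) :
    Summable fun n => |f (u (n + 1)) - f (u n)| := by
  refine summable_of_sum_range_le (c := (eVariationOn f Set.univ).toReal)
    (fun _ => abs_nonneg _) fun n => ?_
  have hle := eVariationOn.sum_le (f := f) (n := n) hu fun i => Set.mem_univ (u i)
  simp only [edist_dist, Real.dist_eq] at hle
  rw [← ENNReal.ofReal_sum_of_nonneg fun _ _ => abs_nonneg _] at hle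
  exact (ENNReal.ofReal_le_iff_le_toReal h).mp hle

theorem BoundedVariationOn.summable_abs_sub_int {f : ℝ → ℝ}
    (h : BoundedVariationOn f Set.univ) {u : ℤ → ℝ} (hu : Monotone u) :
    Summable fun k => |f (u (k + 1)) - f (u k)| := by
  refine Summable.of_nat_of_neg_add_one ?_ ?_
  · exact h.summable_abs_sub_nat (u := fun n : ℕ => u n) fun i j hij => hu (by exact_mod_cast hij)
  · have hneg : BoundedVariationOn (fun x => f (-x)) Set.univ := by
      have := eVariationOn.comp_le_of_antitoneOn f (s := Set.univ) (t := Set.univ)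
        (fun x : ℝ => -x) (fun x _ y _ hxy => neg_le_neg hxy) (fun _ _ => Set.mem_univ _)
      exact ne_top_of_le_ne_top h this
    have := hneg.summable_abs_sub_nat (u := fun n : ℕ => -u (-n))
      fun i j hij => neg_le_neg (hu (by simpa using hij))
    refine this.congr fun n => ?_
    rw [abs_sub_comm]
    simp

theorem BoundedVariationOn.exists_abs_le {f : ℝ → ℝ} (h : BoundedVariationOn f Set.univ) :
    ∃ C, ∀ x, |f x| ≤ C := by
  refine ⟨|f 0| + (eVariationOn f Set.univ).toReal, fun x => ?_⟩
  have := h.dist_le (Set.mem_univ x) (Set.mem_univ 0)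
  rw [Real.dist_eq] at this
  linarith [abs_sub_abs_le_abs_sub (f x) (f 0)]

theorem summable_abs_sub_shift {c : ℤ → ℝ} (h : Summable fun k => |c (k + 1) - c k|) (n : ℕ) :
    Summable fun k => |c k - c (k - n)| := by
  induction n with
  | zero => simp
  | succ n ih =>
    have hs : Summable fun k : ℤ => |c (k - n) - c (k - (n + 1 : ℕ))| := by
      refine ((Equiv.subRight ((n : ℤ) + 1)).summable_iff.mpr h).congr fun k => ?_
      simp only [Function.comp_apply, Equiv.subRight_apply]
      push_cast
      congr 3
      ring_nf
    exact Summable.of_nonneg_of_le (fun _ => abs_nonneg _)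
      (fun k => abs_sub_le _ (c (k - n)) _) (ih.add hs)

section Kernel

variable {χ : ℝ → ℝ}

theorem Continuous.integral_zero_sub_integral_zero (hcont : Continuous χ) (a b k : ℝ) :
    (∫ x in (0 : ℝ)..b - k, χ x) - (∫ x in (0 : ℝ)..a - k, χ x) = ∫ x in a..b, χ (x - k) := by
  rw [intervalIntegral.integral_interval_sub_left (hcont.intervalIntegrable _ _)
    (hcont.intervalIntegrable _ _), intervalIntegral.integral_comp_sub_right]

theorem summable_abs_integral_translate (hcont : Continuous χ) {A : ℝ}
    (habs : ∀ u : ℝ, Summable fun k : ℤ => |χ (u - k)|)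
    (hA : ∀ u : ℝ, ∑' k : ℤ, |χ (u - k)| ≤ A) (a b : ℝ) :
    Summable fun k : ℤ => |∫ x in a..b, χ (x - k)| := by
  wlog hab : a ≤ b generalizing a b
  · refine (this b a (le_of_not_ge hab)).congr fun k => ?_
    rw [intervalIntegral.integral_symm, abs_neg]
  refine summable_of_sum_le (c := ∫ _ in a..b, A) (fun _ => abs_nonneg _) fun s => ?_
  have hint : ∀ k : ℤ, IntervalIntegrable (fun x => |χ (x - k)|) volume a b := fun k =>
    Continuous.intervalIntegrable (by fun_prop) _ _
  calc ∑ k ∈ s, |∫ x in a..b, χ (x - k)|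
      ≤ ∑ k ∈ s, ∫ x in a..b, |χ (x - k)| :=
        Finset.sum_le_sum fun k _ => intervalIntegral.abs_integral_le_integral_abs hab
    _ = ∫ x in a..b, ∑ k ∈ s, |χ (x - k)| :=
        (intervalIntegral.integral_finsetSum fun k _ => hint k).symm
    _ ≤ ∫ _ in a..b, A := by
        refine intervalIntegral.integral_mono_on hab
          (Continuous.intervalIntegrable (by fun_prop) _ _) (by simp) fun x _ => ?_
        exact ((habs x).sum_le_tsum s fun _ _ => abs_nonneg _).trans (hA x)

theorem avgKernel_eq (χ : ℝ → ℝ) (m : ℕ) (t : ℝ) :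
    avgKernel χ m t = 1 / (m : ℝ) * ∫ x in (t - (m : ℝ) / 2)..(t + (m : ℝ) / 2), χ x := by
  rw [avgKernel, intervalIntegral.integral_comp_add_left, sub_eq_add_neg]

theorem avgKernel_sub_int (χ : ℝ → ℝ) (m : ℕ) (s k : ℝ) :
    avgKernel χ m (s - k) =
      1 / (m : ℝ) * ∫ x in (s - (m : ℝ) / 2)..(s + (m : ℝ) / 2), χ (x - k) := by
  rw [avgKernel_eq, intervalIntegral.integral_comp_sub_right]
  ring_nf

/-- Summation by parts for the averaged sampling series, relative to its value at `0`. -/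
theorem avgSamplingSeries_eq_add_tsum (hcont : Continuous χ) {A : ℝ}
    (habs : ∀ u : ℝ, Summable fun k : ℤ => |χ (u - k)|)
    (hA : ∀ u : ℝ, ∑' k : ℤ, |χ (u - k)| ≤ A) {f : ℝ → ℝ} {C : ℝ} (hC : ∀ x, |f x| ≤ C)
    (m : ℕ) (w t : ℝ) :
    avgSamplingSeries χ f m w t = avgSamplingSeries χ f m w 0 + 1 / (m : ℝ) *
      ∑' k : ℤ, (f (k / w) - f ((k - m : ℤ) / w)) *
        ∫ x in ((m : ℝ) / 2)..(w * t + (m : ℝ) / 2), χ (x - k) := by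
  have hsum : ∀ (g : ℤ → ℝ) (_ : ∀ k, |g k| ≤ C) (a b : ℝ),
      Summable fun k : ℤ => g k * ∫ x in a..b, χ (x - k) := by
    intro g hg a b
    refine Summable.of_norm_bounded
      ((summable_abs_integral_translate hcont habs hA a b).mul_left C) fun k => ?_
    rw [Real.norm_eq_abs, abs_mul]
    exact mul_le_mul_of_nonneg_right (hg k) (abs_nonneg _)
  have hseries : ∀ s, avgSamplingSeries χ f m w s = 1 / (m : ℝ) *
      ∑' k : ℤ, f (k / w) * ∫ x in (w * s - (m : ℝ) / 2)..(w * s + (m : ℝ) / 2), χ (x - k) := by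
    intro s
    rw [avgSamplingSeries, ← tsum_mul_left]
    refine tsum_congr fun k => ?_
    rw [avgKernel_sub_int]
    ring
  have hshift : ∑' k : ℤ, f ((k - m : ℤ) / w) *
      (∫ x in ((m : ℝ) / 2)..(w * t + (m : ℝ) / 2), χ (x - k)) =
      ∑' k : ℤ, f (k / w) *
        ∫ x in (-((m : ℝ) / 2))..(w * t - (m : ℝ) / 2), χ (x - k) := by
    rw [← (Equiv.subRight (m : ℤ)).tsum_eq (fun k : ℤ => f (k / w) *
        ∫ x in (-((m : ℝ) / 2))..(w * t - (m : ℝ) / 2), χ (x - k))]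
    refine tsum_congr fun k => ?_
    simp only [Equiv.subRight_apply, intervalIntegral.integral_comp_sub_right]
    push_cast
    ring_nf
  rw [hseries, hseries, ← mul_add]
  congr 1
  simp only [sub_mul]
  rw [(hsum _ (fun k => hC _) _ _).tsum_sub (hsum _ (fun k => hC _) _ _), hshift,
    ← (hsum _ (fun k => hC _) _ _).tsum_sub (hsum _ (fun k => hC _) _ _),
    ← (hsum _ (fun k => hC _) _ _).tsum_add
      ((hsum _ (fun k => hC _) _ _).sub (hsum _ (fun k => hC _) _ _))]
  refine tsum_congr fun k => ?_
  simp only [← hcont.integral_zero_sub_integral_zero]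
  ring_nf

theorem hasDerivAt_tsum_mul_integral (hcont : Continuous χ) {A : ℝ}
    (habs : ∀ u : ℝ, Summable fun k : ℤ => |χ (u - k)|)
    (hA : ∀ u : ℝ, ∑' k : ℤ, |χ (u - k)| ≤ A) {d : ℤ → ℝ} (hd : Summable fun k => |d k|)
    (a y : ℝ) :
    HasDerivAt (fun y => ∑' k : ℤ, d k * ∫ x in a..y, χ (x - k))
      (∑' k : ℤ, d k * χ (y - k)) y := by
  refine hasDerivAt_tsum (g := fun (k : ℤ) y => d k * ∫ x in a..y, χ (x - k))
    (g' := fun k z => d k * χ (z - k)) (y₀ := a) (hd.mul_right A) (fun k z => ?_) (fun k z => ?_) ?_ y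
  · have hk : Continuous fun x : ℝ => χ (x - k) := by fun_prop
    exact (hk.integral_hasStrictDerivAt a z).hasDerivAt.const_mul (d k)
  · rw [Real.norm_eq_abs, abs_mul]
    refine mul_le_mul_of_nonneg_left ?_ (abs_nonneg _)
    exact ((habs z).le_tsum k fun _ _ => abs_nonneg _).trans (hA z)
  · simp

end Kernel

theorem kantorovich_deriv_eq {χ f : ℝ → ℝ} (hAC : ACloc f) {w : ℝ} (hw : 0 < w) (t : ℝ) (j : ℤ) :
    kantorovich χ (deriv f) w (t + j / w) =
      w * ∑' k : ℤ, (f ((k + j + 1 : ℤ) / w) - f ((k + j : ℤ) / w)) * χ (w * t - k) := by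
  rw [kantorovich, ← (Equiv.addRight j).tsum_eq, ← tsum_mul_left]
  refine tsum_congr fun k => ?_
  rw [hAC.integral_deriv_eq_sub (by gcongr; linarith)]
  have harg : w * (t + j / w) - ((k + j : ℤ) : ℝ) = w * t - k := by
    push_cast
    field_simp
    ring
  simp only [Equiv.coe_addRight, harg]
  push_cast
  ring

theorem sum_kantorovich_deriv_eq {χ f : ℝ → ℝ} (hAC : ACloc f) {C : ℝ} (hC : ∀ x, |f x| ≤ C)
    (habs : ∀ u : ℝ, Summable fun k : ℤ => |χ (u - k)|) (m : ℕ) {w : ℝ} (hw : 0 < w) (t : ℝ) :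
    ∑ i ∈ Finset.Icc 1 m,
      kantorovich χ (deriv f) w (t - ((m : ℝ) - 2 * ((i : ℝ) - 1)) / (2 * w)) =
    w * ∑' k : ℤ, (f (k / w) - f ((k - m : ℤ) / w)) * χ (w * t + (m : ℝ) / 2 - k) := by
  set y := w * t + (m : ℝ) / 2 with hy
  have hsum : ∀ i : ℕ, Summable fun k : ℤ =>
      (f ((k - m + i + 1 : ℤ) / w) - f ((k - m + i : ℤ) / w)) * χ (y - k) := by
    intro i
    refine Summable.of_norm_bounded ((habs y).mul_left (C + C)) fun k => ?_
    rw [Real.norm_eq_abs, abs_mul]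
    exact mul_le_mul_of_nonneg_right
      ((abs_sub _ _).trans (add_le_add (hC _) (hC _))) (abs_nonneg _)
  have hterm : ∀ i ∈ Finset.range m,
      kantorovich χ (deriv f) w (t - ((m : ℝ) - 2 * (((1 + i : ℕ) : ℝ) - 1)) / (2 * w)) =
      w * ∑' k : ℤ, (f ((k - m + i + 1 : ℤ) / w) - f ((k - m + i : ℤ) / w)) * χ (y - k) := by
    intro i _
    have harg : t - ((m : ℝ) - 2 * (((1 + i : ℕ) : ℝ) - 1)) / (2 * w) =
        y / w + ((i - m : ℤ) : ℝ) / w := by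
      rw [hy]
      push_cast
      field_simp
      ring
    rw [harg, kantorovich_deriv_eq hAC hw, mul_div_cancel₀ y hw.ne']
    simp only [← add_sub_assoc, add_sub_right_comm]
  rw [← Finset.Ico_add_one_right_eq_Icc, Finset.sum_Ico_eq_sum_range, Nat.add_sub_cancel,
    Finset.sum_congr rfl hterm, ← Finset.mul_sum, ← Summable.tsum_finsetSum fun i _ => hsum i]
  congr 1
  refine tsum_congr fun k => ?_
  rw [← Finset.sum_mul]
  have htel := Finset.sum_range_sub (fun i : ℕ => f ((k - m + i : ℤ) / w)) m
  simp only [Nat.cast_add, Nat.cast_one, ← add_assoc] at htel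
  rw [htel]
  simp

theorem stmt12 (χ f : ℝ → ℝ)
    (hBV : BoundedVariationOn f Set.univ) (hAC : ACloc f)
    (hcont : Continuous χ) (hint : Integrable χ) (A : ℝ)
    (habs : ∀ u : ℝ, Summable fun k : ℤ => |χ (u - k)|)
    (hA : ∀ u : ℝ, ∑' k : ℤ, |χ (u - k)| ≤ A)
    (m : ℕ) (hm : 1 ≤ m) (w : ℝ) (hw : 0 < w) :
    ∀ t : ℝ,
      HasDerivAt (avgSamplingSeries χ f m w)
        ((1 / (m : ℝ)) * ∑ i ∈ Finset.Icc 1 m,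
          kantorovich χ (deriv f) w (t - ((m : ℝ) - 2 * ((i : ℝ) - 1)) / (2 * w))) t := by
  obtain ⟨C, hC⟩ := hBV.exists_abs_le
  have hd : Summable fun k : ℤ => |f (k / w) - f ((k - m : ℤ) / w)| := by
    refine summable_abs_sub_shift (c := fun k : ℤ => f (k / w)) ?_ m
    refine hBV.summable_abs_sub_int (u := fun k : ℤ => (k : ℝ) / w) fun i j hij => ?_
    have : (i : ℝ) ≤ j := by exact_mod_cast hij
    dsimp only
    gcongr
  intro t
  rw [sum_kantorovich_deriv_eq hAC hC habs m hw t,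
    funext (avgSamplingSeries_eq_add_tsum hcont habs hA hC m w)]
  have hlin : HasDerivAt (fun s => w * s + (m : ℝ) / 2) w t := by
    simpa using ((hasDerivAt_id t).const_mul w).add_const ((m : ℝ) / 2)
  have hcomp := (hasDerivAt_tsum_mul_integral hcont habs hA hd ((m : ℝ) / 2) _).comp t hlin
  rw [mul_comm w]
  exact (hcomp.const_mul (1 / (m : ℝ))).const_add _
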